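/- arXiv:2003.06147 — 7 statements merged into one kernel-verified Lean document; each statement's English description precedes it below -/
import Mathlib

section
/- Let 1 ≤ m ≤ n be integers and let λ = (λ_1,…,λ_n) ∈ Γ_m with λ_1 ≥ λ_2 ≥ ⋯ ≥ λ_n. Then σ_{m−1}(λ|1) > 0, and for all 1 ≤ i ≤ j ≤ n one has σ_{m−1}(λ|i) ≤ σ_{m−1}(λ|j); in particular σ_{m−1}(λ|n) ≥ σ_{m−1}(λ|n−1) ≥ ⋯ ≥ σ_{m−1}(λ|m) ≥ ⋯ ≥ σ_{m−1}(λ|1) > 0. -/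
/-- The `m`-th elementary symmetric function of `λ = (λ_1, …, λ_n) ∈ ℝⁿ`. -/
def esymm (n m : ℕ) (lam : Fin n → ℝ) : ℝ :=
  ∑ s ∈ (Finset.univ : Finset (Fin n)).powersetCard m, ∏ i ∈ s, lam i

/-- The Gårding cone `Γ_m = {λ ∈ ℝⁿ : σ_j(λ) > 0 for all 1 ≤ j ≤ m}`. -/
def GardingCone (n m : ℕ) : Set (Fin n → ℝ) :=
  {lam | ∀ j : ℕ, 1 ≤ j → j ≤ m → 0 < esymm n j lam}

open Polynomial in
/-- By Rolle's theorem, the derivative of a real-rooted polynomial is real-rooted. -/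
theorem Polynomial.Splits.derivative_real {p : ℝ[X]} (hp : p.Splits) :
    (derivative p).Splits := by
  rw [splits_iff_card_roots] at hp ⊢
  have h₁ := card_roots_le_derivative p
  have h₂ := natDegree_derivative_le p
  have h₃ := card_roots' (derivative p)
  omega

open Polynomial in
/-- The lowest-order Newton inequality for a real-rooted polynomial. -/
theorem Polynomial.Splits.two_mul_coeff_zero_mul_coeff_two_le {p : ℝ[X]} (hp : p.Splits) :
    2 * (p.coeff 0 * p.coeff 2) ≤ p.coeff 1 ^ 2 := by
  obtain ⟨s, hs⟩ := splits_iff_exists_multiset.1 hp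
  rw [hs]
  generalize p.leadingCoeff = a
  clear hs
  induction s using Multiset.induction_on with
  | empty => simp [coeff_C]
  | cons r s ih =>
    rw [Multiset.map_cons, Multiset.prod_cons, mul_left_comm (C a)]
    generalize C a * (s.map fun x => X - C x).prod = q at ih ⊢
    have h₀ : ((X - C r) * q).coeff 0 = -(r * q.coeff 0) := by simp [sub_mul]
    have h₁ : ((X - C r) * q).coeff 1 = q.coeff 0 - r * q.coeff 1 := by
      rw [sub_mul, coeff_sub, coeff_X_mul, coeff_C_mul]
    have h₂ : ((X - C r) * q).coeff 2 = q.coeff 1 - r * q.coeff 2 := by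
      rw [sub_mul, coeff_sub, coeff_X_mul, coeff_C_mul]
    rw [h₀, h₁, h₂]
    nlinarith [mul_le_mul_of_nonneg_left ih (sq_nonneg r), sq_nonneg (q.coeff 0)]

open Polynomial in
/-- A Newton inequality for consecutive coefficients of a real-rooted polynomial. -/
theorem Polynomial.Splits.coeff_mul_coeff_le {p : ℝ[X]} (hp : p.Splits) (k : ℕ) :
    (k + 2) * (p.coeff k * p.coeff (k + 2)) ≤ (k + 1) * p.coeff (k + 1) ^ 2 := by
  induction k generalizing p with
  | zero => simpa using hp.two_mul_coeff_zero_mul_coeff_two_le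
  | succ k ih =>
    have h := ih hp.derivative_real
    simp only [coeff_derivative] at h
    push_cast at h ⊢
    have hk : (0 : ℝ) < (k + 1) * (k + 2) := by positivity
    refine le_of_mul_le_mul_left ?_ hk
    linear_combination h

open Polynomial in
/-- The elementary symmetric functions are the coefficients of `∏ i, (1 + λ_i X)`. -/
theorem coeff_prod_one_add_C_mul_X (n k : ℕ) (lam : Fin n → ℝ) :
    (∏ i, (1 + C (lam i) * X)).coeff k = esymm n k lam := by
  simp only [Finset.prod_one_add, Finset.prod_mul_distrib, Finset.prod_const, ← map_prod,
    finsetSum_coeff, coeff_C_mul_X_pow, esymm, Finset.powersetCard_eq_filter, Finset.sum_filter,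
    eq_comm (a := k)]

open Polynomial in
/-- Newton's inequality, with weakened constant, for elementary symmetric functions. -/
theorem esymm_mul_esymm_le_sq (n k : ℕ) (lam : Fin n → ℝ) :
    esymm n k lam * esymm n (k + 2) lam ≤ esymm n (k + 1) lam ^ 2 := by
  have hs : (∏ i, (1 + C (lam i) * X)).Splits := Splits.prod fun i _ =>
    Splits.of_natDegree_le_one (by compute_degree)
  have h := hs.coeff_mul_coeff_le k
  simp only [coeff_prod_one_add_C_mul_X] at h
  have hk : (0 : ℝ) < k + 2 := by positivity
  refine le_of_mul_le_mul_left (h.trans ?_) hk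
  gcongr
  norm_num

theorem esymm_zero_right (n : ℕ) (lam : Fin n → ℝ) : esymm n 0 lam = 1 := by
  simp [esymm]

open Polynomial in
/-- The expansion `σ_{k+1}(λ) = σ_{k+1}(λ|i) + λ_i σ_k(λ|i)`. -/
theorem esymm_succ_eq_update (n k : ℕ) (lam : Fin n → ℝ) (i : Fin n) :
    esymm n (k + 1) lam = esymm n (k + 1) (Function.update lam i 0) +
      lam i * esymm n k (Function.update lam i 0) := by
  have h : ∏ j, (1 + C (lam j) * X) =
      (1 + C (lam i) * X) * ∏ j, (1 + C (Function.update lam i 0 j) * X) := by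
    rw [← Finset.mul_prod_erase _ _ (Finset.mem_univ i),
      ← Finset.mul_prod_erase _ (fun j => 1 + C (Function.update lam i 0 j) * X)
        (Finset.mem_univ i)]
    simp only [Function.update_self, map_zero, zero_mul, add_zero, one_mul]
    congr 1
    refine Finset.prod_congr rfl fun j hj => ?_
    rw [Function.update_of_ne (Finset.ne_of_mem_erase hj)]
  rw [← coeff_prod_one_add_C_mul_X, h, add_mul, one_mul, coeff_add, mul_assoc, coeff_C_mul,
    coeff_X_mul, coeff_prod_one_add_C_mul_X, coeff_prod_one_add_C_mul_X]

/-- If `λ ∈ Γ_m`, then `σ_k(λ|i) > 0` for all `k < m`. -/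
theorem esymm_update_pos {n m : ℕ} {lam : Fin n → ℝ} (hlam : lam ∈ GardingCone n m)
    (i : Fin n) {k : ℕ} (hk : k < m) : 0 < esymm n k (Function.update lam i 0) := by
  induction k with
  | zero => simp [esymm_zero_right]
  | succ k ih =>
    have h₀ := ih (by omega)
    have h₁ := hlam (k + 1) (by omega) (by omega)
    have h₂ := hlam (k + 2) (by omega) (by omega)
    have hN := esymm_mul_esymm_le_sq n k (Function.update lam i 0)
    rw [esymm_succ_eq_update n _ lam i] at h₁ h₂
    by_contra! hneg
    nlinarith [mul_pos h₀ h₂, mul_nonneg_of_nonpos_of_nonpos hneg (neg_nonpos.2 h₁.le)]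

/-- If `λ ∈ Γ_m`, then `(λ|i) ∈ Γ_{m-1}`. -/
theorem update_mem_gardingCone {n m : ℕ} {lam : Fin n → ℝ} (hlam : lam ∈ GardingCone n (m + 1))
    (i : Fin n) : Function.update lam i 0 ∈ GardingCone n m :=
  fun _ _ hj => esymm_update_pos hlam i (by omega)

/-- For `λ ∈ Γ_m` with `λ_1 ≥ λ_2 ≥ ⋯ ≥ λ_n`, one has `σ_{m-1}(λ|1) > 0` and
`σ_{m-1}(λ|i) ≤ σ_{m-1}(λ|j)` for all `i ≤ j`; in particular
`σ_{m-1}(λ|n) ≥ ⋯ ≥ σ_{m-1}(λ|m) ≥ ⋯ ≥ σ_{m-1}(λ|1) > 0`. -/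
theorem esymm_update_monotone_and_pos (n m : ℕ) (hm : 1 ≤ m) (hmn : m ≤ n)
    (lam : Fin n → ℝ) (hlam : lam ∈ GardingCone n m)
    (hsorted : ∀ i j : Fin n, i ≤ j → lam j ≤ lam i) :
    0 < esymm n (m - 1) (Function.update lam (⟨0, by omega⟩ : Fin n) 0) ∧
      ∀ i j : Fin n, i ≤ j →
        esymm n (m - 1) (Function.update lam i 0) ≤
          esymm n (m - 1) (Function.update lam j 0) := by
  refine ⟨esymm_update_pos hlam _ (by omega), fun i j hij => ?_⟩
  obtain rfl | hne := eq_or_ne i j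
  · rfl
  obtain ⟨m, rfl⟩ := Nat.exists_eq_add_of_le' hm
  rw [Nat.add_sub_cancel]
  cases m with
  | zero => simp [esymm_zero_right]
  | succ m =>
    have hpos := esymm_update_pos (update_mem_gardingCone hlam i) j (Nat.lt_succ_self m)
    rw [esymm_succ_eq_update n m (Function.update lam i 0) j,
      esymm_succ_eq_update n m (Function.update lam j 0) i, Function.update_comm hne.symm,
      Function.update_of_ne hne, Function.update_of_ne hne.symm]
    gcongr
    exact hsorted i j hij
end

section
/- Let 1 ≤ m ≤ n be integers. There exists a constant c(n,m) > 0, depending only on n and m, such that for every λ = (λ_1,…,λ_n) ∈ Γ_m with λ_1 ≥ λ_2 ≥ ⋯ ≥ λ_n one has σ_{m−1}(λ|m) ≥ c(n,m)·σ_{m−1}(λ). -/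
open Polynomial in
theorem Polynomial.Splits.derivative_of_real {f : ℝ[X]} (hf : f.Splits) :
    (derivative f).Splits := by
  rw [splits_iff_card_roots] at hf ⊢
  have h₁ := card_roots_le_derivative f
  have h₂ := card_roots' (derivative f)
  have h₃ := natDegree_derivative_le f
  rcases Nat.eq_zero_or_pos f.natDegree with h | h
  · rw [eq_C_of_natDegree_eq_zero h]
    simp
  · omega

open Polynomial in
/-- Laguerre's inequality `f'(0)² ≥ f(0) f''(0)` for a real-rooted polynomial `f`. -/
theorem Polynomial.Splits.two_mul_coeff_zero_mul_coeff_two_le_s6 {f : ℝ[X]} (hf : f.Splits) :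
    2 * (f.coeff 0 * f.coeff 2) ≤ f.coeff 1 ^ 2 := by
  obtain ⟨s, hs⟩ := splits_iff_exists_multiset'.mp hf
  have key : ∀ s : Multiset ℝ, 2 * ((s.map (X + C ·)).prod.coeff 0 *
      (s.map (X + C ·)).prod.coeff 2) ≤ (s.map (X + C ·)).prod.coeff 1 ^ 2 := by
    intro s
    induction s using Multiset.induction with
    | empty => simp [coeff_one]
    | cons a s ih =>
      simp only [Multiset.map_cons, Multiset.prod_cons, add_mul, coeff_add, coeff_C_mul,
        coeff_X_mul, coeff_X_mul_zero]
      nlinarith [mul_le_mul_of_nonneg_left ih (sq_nonneg a),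
        sq_nonneg ((s.map (X + C ·)).prod.coeff 0)]
  rw [hs]
  simp only [coeff_C_mul]
  nlinarith [mul_le_mul_of_nonneg_left (key s) (sq_nonneg f.leadingCoeff)]

open Polynomial in
/-- A weak form of Newton's inequality for the coefficients of a real-rooted polynomial. -/
theorem Polynomial.Splits.coeff_mul_coeff_le_s6 (k : ℕ) {f : ℝ[X]} (hf : f.Splits) :
    (k + 2) * (f.coeff k * f.coeff (k + 2)) ≤ (k + 1) * f.coeff (k + 1) ^ 2 := by
  induction k generalizing f with
  | zero => simpa using hf.two_mul_coeff_zero_mul_coeff_two_le_s6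
  | succ k ih =>
    have h := ih hf.derivative_of_real
    simp only [coeff_derivative] at h
    push_cast at h ⊢
    have hk : (0 : ℝ) < (k + 1) * (k + 2) := by positivity
    refine le_of_mul_le_mul_left ?_ hk
    calc _ = _ := ?_
      _ ≤ _ := h
      _ = _ := ?_
    · ring_nf
    · ring_nf

namespace Multiset

theorem esymm_cons_succ {R : Type*} [CommSemiring R] (a : R) (s : Multiset R) (k : ℕ) :
    (a ::ₘ s).esymm (k + 1) = s.esymm (k + 1) + a * s.esymm k := by
  simp [esymm, powersetCard_cons, sum_map_mul_left]

theorem esymm_zero_right {R : Type*} [CommSemiring R] (s : Multiset R) : s.esymm 0 = 1 := by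
  simp [esymm]

open Polynomial in
theorem coeff_prod_one_add_C_mul_X {R : Type*} [CommSemiring R] (s : Multiset R) (k : ℕ) :
    (s.map fun a => 1 + C a * X).prod.coeff k = s.esymm k := by
  induction s using Multiset.induction generalizing k with
  | empty => cases k <;> simp [esymm, coeff_one, powersetCard_zero_right]
  | cons a s ih =>
    cases k with
    | zero => simp [add_mul, mul_assoc, ih, esymm_zero_right]
    | succ k => simp [add_mul, mul_assoc, ih, esymm_cons_succ]

open Polynomial in
/-- A weak form of Newton's inequality for elementary symmetric functions. -/
theorem esymm_mul_esymm_le (s : Multiset ℝ) (k : ℕ) :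
    (k + 2) * (s.esymm k * s.esymm (k + 2)) ≤ (k + 1) * s.esymm (k + 1) ^ 2 := by
  have hs : (s.map fun a : ℝ => 1 + C a * X).prod.Splits := by
    refine Splits.multisetProd fun f hf => ?_
    obtain ⟨a, -, rfl⟩ := mem_map.mp hf
    refine Splits.of_natDegree_le_one ?_
    compute_degree
  simpa only [coeff_prod_one_add_C_mul_X] using hs.coeff_mul_coeff_le_s6 k

/-- Deleting an entry maps the Gårding cone `Γ_{m+1}` into `Γ_m`. -/
theorem esymm_pos_of_cons {m : ℕ} {x : ℝ} {s : Multiset ℝ}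
    (h : ∀ j ≤ m + 1, 0 < (x ::ₘ s).esymm j) : ∀ j ≤ m, 0 < s.esymm j := by
  induction m with
  | zero =>
    intro j hj
    obtain rfl : j = 0 := by omega
    simp [esymm_zero_right]
  | succ m ih =>
    have hs := ih fun j hj => h j (by omega)
    intro j hj
    rcases hj.lt_or_eq with hj | rfl
    · exact hs j (by omega)
    have ha := hs m le_rfl
    have h₁ := h (m + 1) (by omega)
    have h₂ := h (m + 2) le_rfl
    rw [esymm_cons_succ] at h₁ h₂
    have hN := s.esymm_mul_esymm_le m
    have hN' : s.esymm m * s.esymm (m + 2) ≤ s.esymm (m + 1) ^ 2 := by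
      have hm : (0 : ℝ) < m + 2 := by positivity
      refine le_of_mul_le_mul_left (hN.trans ?_) hm
      nlinarith [sq_nonneg (s.esymm (m + 1))]
    by_contra! hb
    nlinarith [mul_nonpos_of_nonneg_of_nonpos h₁.le hb, mul_pos ha h₂]

/-- If `x` is at most each of `m` other entries of a vector in `Γ_{m+1}`, deleting `x` preserves
`σ_m` up to a constant depending only on `m`. -/
theorem exists_const_esymm_cons_le (m : ℕ) :
    ∃ c : ℝ, 0 < c ∧ ∀ (t u : Multiset ℝ) (x : ℝ), card t = m → (∀ y ∈ t, x ≤ y) →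
      (∀ j ≤ m + 1, 0 < (x ::ₘ (t + u)).esymm j) →
      (x ::ₘ (t + u)).esymm m ≤ c * (t + u).esymm m := by
  induction m with
  | zero => exact ⟨1, one_pos, fun t u x _ _ _ => by simp [esymm_zero_right]⟩
  | succ m ih =>
    obtain ⟨c, hc, ih⟩ := ih
    refine ⟨1 + c * (m + 3), by positivity, fun t u x ht hx hpos => ?_⟩
    obtain ⟨y, t, rfl⟩ : ∃ y t', t = y ::ₘ t' := by
      obtain ⟨y, hy⟩ := card_pos_iff_exists_mem.mp (by omega : 0 < card t)
      exact ⟨y, exists_cons_of_mem hy⟩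
    have hxy : x ≤ y := hx y (mem_cons_self y t)
    rw [cons_add] at hpos ⊢
    have hp := esymm_pos_of_cons hpos (m + 1) le_rfl
    have hσ := hpos (m + 2) le_rfl
    rw [cons_swap] at hpos ⊢
    have hpos' := esymm_pos_of_cons hpos
    have hq := hpos' (m + 1) le_rfl
    have hB := esymm_pos_of_cons hpos' m le_rfl
    have hS := hpos' m (by omega)
    have hSB := ih t u x (by simpa using ht) (fun z hz => hx z (mem_cons_of_mem hz)) hpos'
    have hN := (t + u).esymm_mul_esymm_le m
    rw [esymm_cons_succ y (x ::ₘ (t + u))]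
    simp only [esymm_cons_succ] at hp hq hσ ⊢
    generalize (x ::ₘ (t + u)).esymm m = S at *
    generalize (t + u).esymm m = B at *
    generalize (t + u).esymm (m + 1) = C at *
    generalize (t + u).esymm (m + 2) = D at *
    have hqp : C + x * B ≤ C + y * B := by gcongr
    have hm : (0 : ℝ) < m + 2 := by positivity
    have hC : C ^ 2 ≤ ((m + 2) * (C + y * B)) ^ 2 := by
      have h₁ : (C + x * B) * (C + y * B) ≤ (C + y * B) ^ 2 := by
        rw [sq]; gcongr
      have h₂ : 0 < (m + 2) * ((C + x * B) * (C + y * B) - C ^ 2 + B * D) := by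
        have := mul_pos hm (mul_pos hB hσ)
        linarith
      have h₃ : C ^ 2 ≤ (m + 2) * (C + y * B) ^ 2 := by nlinarith
      have h₄ : (m + 2 : ℝ) * (C + y * B) ^ 2 ≤ (m + 2) ^ 2 * (C + y * B) ^ 2 := by
        gcongr
        nlinarith
      nlinarith
    have hC' : -C ≤ (m + 2) * (C + y * B) := (abs_le_of_sq_le_sq' hC (by positivity)).1 |> neg_le.mp
    have hyB : y * B ≤ (m + 3) * (C + y * B) := by linarith
    have hyS : y * S ≤ c * ((m + 3) * (C + y * B)) := by
      rcases le_total y 0 with hy | hy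
      · exact (mul_nonpos_of_nonpos_of_nonneg hy hS.le).trans (by positivity)
      · calc y * S ≤ y * (c * B) := by gcongr
          _ = c * (y * B) := by ring
          _ ≤ _ := by gcongr
    linarith

end Multiset

theorem esymm_eq_multiset_esymm (n m : ℕ) (lam : Fin n → ℝ) :
    esymm n m lam = ((Finset.univ : Finset (Fin n)).val.map lam).esymm m := by
  rw [Finset.esymm_map_val, esymm]

/-- There exists `c(n,m) > 0` such that for every `λ ∈ Γ_m` with
`λ_1 ≥ λ_2 ≥ ⋯ ≥ λ_n` one has `σ_{m-1}(λ|m) ≥ c(n,m) · σ_{m-1}(λ)`. -/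
theorem exists_const_esymm_update_ge (n m : ℕ) (hm : 1 ≤ m) (hmn : m ≤ n) :
    ∃ c : ℝ, 0 < c ∧
      ∀ lam : Fin n → ℝ, lam ∈ GardingCone n m →
        (∀ i j : Fin n, i ≤ j → lam j ≤ lam i) →
        c * esymm n (m - 1) lam ≤
          esymm n (m - 1) (Function.update lam (⟨m - 1, by omega⟩ : Fin n) 0) := by
  obtain ⟨k, rfl⟩ : ∃ k, m = k + 1 := ⟨m - 1, by omega⟩
  obtain ⟨c, hc, h⟩ := Multiset.exists_const_esymm_cons_le k
  refine ⟨c⁻¹, inv_pos.mpr hc, fun lam hlam hanti => ?_⟩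
  simp only [Nat.add_sub_cancel]
  set p : Fin n := ⟨k, by omega⟩ with hp
  have huniv : (Finset.univ : Finset (Fin n)).val =
      p ::ₘ ((Finset.Iio p).val + (Finset.Ioi p).val) := by
    have hd : Disjoint (Finset.Iio p) (Finset.Ioi p) := by
      simp only [Finset.disjoint_left, Finset.mem_Iio, Finset.mem_Ioi]
      exact fun _ => lt_asymm
    rw [← Finset.disjUnion_val _ _ hd, ← Finset.cons_val (by simp)]
    congr 1
    ext i
    simp [em]
  have hval : (Finset.univ : Finset (Fin n)).val.map lam =
      lam p ::ₘ ((Finset.Iio p).val.map lam + (Finset.Ioi p).val.map lam) := by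
    rw [huniv, Multiset.map_cons, Multiset.map_add]
  have hupd : (Finset.univ : Finset (Fin n)).val.map (Function.update lam p 0) =
      0 ::ₘ ((Finset.Iio p).val.map lam + (Finset.Ioi p).val.map lam) := by
    rw [huniv, Multiset.map_cons, Multiset.map_add, Function.update_self]
    congr 2 <;> refine Multiset.map_congr rfl fun i hi => Function.update_of_ne ?_ _ _
    · exact (Finset.mem_Iio.mp hi).ne
    · exact (Finset.mem_Ioi.mp hi).ne'
  have hzero : ∀ (s : Multiset ℝ) (j : ℕ), (0 ::ₘ s).esymm j = s.esymm j := by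
    rintro s (_ | j)
    · simp [Multiset.esymm_zero_right]
    · simp [Multiset.esymm_cons_succ]
  rw [esymm_eq_multiset_esymm, esymm_eq_multiset_esymm, hupd, hzero, hval, inv_mul_le_iff₀ hc]
  refine h _ _ _ (by simp [hp]) ?_ fun j hj => ?_
  · simp only [Multiset.mem_map, Finset.mem_val, Finset.mem_Iio]
    rintro _ ⟨i, hi, rfl⟩
    exact hanti i p hi.le
  · rw [← hval, ← esymm_eq_multiset_esymm]
    rcases Nat.eq_zero_or_pos j with rfl | hj0
    · simp [esymm]
    · exact hlam j hj0 hj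
end

section
/- (Generalized Newton–MacLaurin inequality.) Let n ≥ 1 and let m, l, r, s be integers with m > l ≥ 0, r > s ≥ 0, m ≥ r, l ≥ s, and m ≤ n. Then for every λ ∈ Γ_m one has [ (σ_m(λ)/C_n^m) / (σ_l(λ)/C_n^l) ]^{1/(m−l)} ≤ [ (σ_r(λ)/C_n^r) / (σ_s(λ)/C_n^s) ]^{1/(r−s)}. -/
open Polynomial in
/-- The quadratic inequality between the lowest three coefficients of a monic real-rooted
polynomial. -/
lemma coeff_zero_mul_coeff_two_prod_le (t : Multiset ℝ) :
    2 * (t.card : ℝ) * (t.map fun a => X - C a).prod.coeff 0 *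
        (t.map fun a => X - C a).prod.coeff 2 ≤
      ((t.card : ℝ) - 1) * (t.map fun a => X - C a).prod.coeff 1 ^ 2 := by
  induction t using Multiset.induction_on with
  | empty => simp [coeff_one]
  | cons r t ih =>
    simp only [Multiset.map_cons, Multiset.prod_cons, Multiset.card_cons]
    set P := (t.map fun a => X - C a).prod with hP
    have h0 : ((X - C r) * P).coeff 0 = -(r * P.coeff 0) := by simp [sub_mul]
    have h1 : ((X - C r) * P).coeff 1 = P.coeff 0 - r * P.coeff 1 := by
      simp [sub_mul, coeff_X_mul]
    have h2 : ((X - C r) * P).coeff 2 = P.coeff 1 - r * P.coeff 2 := by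
      simp [sub_mul, coeff_X_mul]
    rw [h0, h1, h2]
    push_cast
    rcases t.card.eq_zero_or_pos with hc | hc
    · have ht : t = 0 := Multiset.card_eq_zero.mp hc
      have hP1 : P = 1 := by rw [hP, ht]; simp
      simp [hP1, ht, coeff_one]
    · have hc' : (0 : ℝ) < t.card := by exact_mod_cast hc
      refine le_of_mul_le_mul_left ?_ hc'
      have key := mul_le_mul_of_nonneg_left ih
        (by positivity : (0 : ℝ) ≤ r ^ 2 * ((t.card : ℝ) + 1))
      nlinarith [sq_nonneg ((t.card : ℝ) * P.coeff 0 + r * P.coeff 1)]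

/-- Differentiation preserves real-rootedness. -/
lemma Polynomial.Splits.derivative_real_s7 {f : Polynomial ℝ} (hf : f.Splits) :
    (Polynomial.derivative f).Splits := by
  rw [Polynomial.splits_iff_card_roots] at hf ⊢
  have h1 := Polynomial.card_roots_le_derivative f
  have h2 := Polynomial.card_roots' (Polynomial.derivative f)
  rw [Polynomial.natDegree_derivative] at h2 ⊢
  omega

/-- **Newton's inequality** for the coefficients of a real-rooted polynomial. -/
lemma Polynomial.Splits.newton_coeff (j k : ℕ) {f : Polynomial ℝ} (hf : f.Splits)
    (hdeg : f.natDegree = k + j) :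
    (k : ℝ) * (j + 2) * (f.coeff j * f.coeff (j + 2)) ≤
      ((k : ℝ) - 1) * (j + 1) * f.coeff (j + 1) ^ 2 := by
  induction j generalizing f with
  | zero =>
    have hcard : f.roots.card = k := by
      rw [Polynomial.splits_iff_card_roots.mp hf, hdeg, add_zero]
    have h := coeff_zero_mul_coeff_two_prod_le f.roots
    rw [hcard] at h
    have hfac := hf.eq_prod_roots
    have hco : ∀ i, f.coeff i = f.leadingCoeff *
        (f.roots.map fun a => Polynomial.X - Polynomial.C a).prod.coeff i := by
      intro i
      conv_lhs => rw [hfac]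
      rw [Polynomial.coeff_C_mul]
    have key := mul_le_mul_of_nonneg_left h (sq_nonneg f.leadingCoeff)
    simp only [zero_add, hco 0, hco 1, hco 2]
    push_cast
    linarith
  | succ j ih =>
    have h := ih hf.derivative_real_s7 (by rw [Polynomial.natDegree_derivative]; omega)
    simp only [Polynomial.coeff_derivative] at h
    push_cast at h ⊢
    have hpos : (0 : ℝ) < ((j : ℝ) + 1) * (j + 2) := by positivity
    refine le_of_mul_le_mul_left ?_ hpos
    rw [show j + 1 + 2 = j + 2 + 1 by ring]
    nlinarith [h]

/-- **Newton's inequality** for normalized elementary symmetric functions. -/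
lemma esymm_div_choose_mul_le_sq {n k : ℕ} (hk : k + 2 ≤ n) (lam : Fin n → ℝ) :
    (esymm n k lam / n.choose k) * (esymm n (k + 2) lam / n.choose (k + 2)) ≤
      (esymm n (k + 1) lam / n.choose (k + 1)) ^ 2 := by
  obtain ⟨j, rfl⟩ := Nat.exists_eq_add_of_le hk
  set f : Polynomial ℝ := ∏ i, (Polynomial.X + Polynomial.C (lam i)) with hf
  have hsplit : f.Splits := Polynomial.Splits.prod fun i _ => Polynomial.Splits.X_add_C (lam i)
  have hdeg : f.natDegree = k + 2 + j := by
    rw [hf, Polynomial.natDegree_prod_of_monic _ _ fun i _ => Polynomial.monic_X_add_C _]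
    simp
  have hco : ∀ i ≤ k + 2 + j, f.coeff i = esymm (k + 2 + j) (k + 2 + j - i) lam := by
    intro i hi
    rw [hf, Finset.prod_X_add_C_coeff _ _ (by simpa using hi)]
    simp [esymm]
  have h := hsplit.newton_coeff j (k + 2) hdeg
  rw [hco j (by omega), hco (j + 1) (by omega), hco (j + 2) (by omega),
    show k + 2 + j - j = k + 2 by omega, show k + 2 + j - (j + 1) = k + 1 by omega,
    show k + 2 + j - (j + 2) = k by omega] at h
  have c1 := Nat.choose_succ_right_eq (k + 2 + j) k
  have c2 := Nat.choose_succ_right_eq (k + 2 + j) (k + 1)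
  rw [show k + 2 + j - k = j + 2 by omega] at c1
  rw [show k + 2 + j - (k + 1) = j + 1 by omega] at c2
  have p0 : (0 : ℝ) < (k + 2 + j).choose k := by exact_mod_cast Nat.choose_pos (by omega)
  have p1 : (0 : ℝ) < (k + 2 + j).choose (k + 1) := by exact_mod_cast Nat.choose_pos (by omega)
  have p2 : (0 : ℝ) < (k + 2 + j).choose (k + 2) := by exact_mod_cast Nat.choose_pos (by omega)
  have c1' : ((k + 2 + j).choose (k + 1) : ℝ) * (k + 1) = (k + 2 + j).choose k * (j + 2) := by
    exact_mod_cast c1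
  have c2' : ((k + 2 + j).choose (k + 2) : ℝ) * (k + 2) = (k + 2 + j).choose (k + 1) * (j + 1) := by
    exact_mod_cast c2
  generalize ((k + 2 + j).choose k : ℝ) = a at *
  generalize ((k + 2 + j).choose (k + 1) : ℝ) = b at *
  generalize ((k + 2 + j).choose (k + 2) : ℝ) = c at *
  generalize esymm (k + 2 + j) k lam = x at *
  generalize esymm (k + 2 + j) (k + 1) lam = y at *
  generalize esymm (k + 2 + j) (k + 2) lam = z at *
  push_cast at h
  rw [div_mul_div_comm, div_pow, div_le_div_iff₀ (by positivity) (by positivity)]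
  have hpos : (0 : ℝ) < (k + 1) * (k + 2) := by positivity
  refine le_of_mul_le_mul_left ?_ hpos
  have e1 : ((k : ℝ) + 1) * (k + 2) * (x * z * b ^ 2) =
      (a * b) * ((k + 2) * (j + 2) * (z * x)) := by
    linear_combination (x * z * b * (k + 2)) * c1'
  have e2 : ((k : ℝ) + 1) * (k + 2) * (y ^ 2 * (a * c)) =
      (a * b) * ((k + 2 - 1) * (j + 1) * y ^ 2) := by
    linear_combination ((k + 1) * y ^ 2 * a) * c2'
  rw [e1, e2]
  exact mul_le_mul_of_nonneg_left h (by positivity)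

/-- The last increment of a concave finite sequence is at most its mean increment. -/
lemma concave_seq_last_increment_le {L : ℕ → ℝ} {m s j : ℕ}
    (hL : ∀ k, k + 2 ≤ m → L k + L (k + 2) ≤ 2 * L (k + 1)) (hsj : s ≤ j) (hjm : j + 1 ≤ m) :
    ((j : ℝ) - s) * (L (j + 1) - L j) ≤ L j - L s := by
  induction j, hsj using Nat.le_induction with
  | base => simp
  | succ j hsj ih =>
    have h1 := ih (by omega)
    have h2 := hL j (by omega)
    have h3 : (s : ℝ) ≤ j := by exact_mod_cast hsj
    push_cast
    nlinarith [mul_le_mul_of_nonneg_left h2 (by linarith : (0 : ℝ) ≤ (j : ℝ) + 1 - s)]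

/-- The mean increment of a concave finite sequence decreases as its right endpoint grows. -/
lemma concave_seq_mean_increment_le {L : ℕ → ℝ} {m s r j : ℕ}
    (hL : ∀ k, k + 2 ≤ m → L k + L (k + 2) ≤ 2 * L (k + 1)) (hsr : s ≤ r) (hrj : r ≤ j)
    (hjm : j ≤ m) :
    ((r : ℝ) - s) * (L j - L s) ≤ ((j : ℝ) - s) * (L r - L s) := by
  induction j, hrj using Nat.le_induction with
  | base => exact le_rfl
  | succ j hrj ih =>
    have h1 := ih (by omega)
    have h2 := concave_seq_last_increment_le hL (hsr.trans hrj) hjm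
    have h3 : (s : ℝ) ≤ r := by exact_mod_cast hsr
    rcases (hsr.trans hrj).eq_or_lt with h | h
    · obtain rfl : r = s := by omega
      simp
    · have h4 : (0 : ℝ) < (j : ℝ) - s := sub_pos.mpr (by exact_mod_cast h)
      refine le_of_mul_le_mul_left ?_ h4
      push_cast
      have h5 := mul_le_mul_of_nonneg_left h2 (sub_nonneg.mpr h3)
      have h6 := mul_le_mul_of_nonneg_left h1 (by linarith : (0 : ℝ) ≤ (j : ℝ) - s + 1)
      nlinarith

/-- Mean increments of a concave finite sequence decrease as both endpoints move right. -/
lemma concave_seq_slope_le {L : ℕ → ℝ} {m l r s : ℕ}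
    (hL : ∀ k, k + 2 ≤ m → L k + L (k + 2) ≤ 2 * L (k + 1)) (hml : l < m) (hrs : s < r)
    (hmr : r ≤ m) (hls : s ≤ l) :
    (L m - L l) / ((m : ℝ) - l) ≤ (L r - L s) / ((r : ℝ) - s) := by
  have hl : (0 : ℝ) < (m : ℝ) - l := sub_pos.mpr (by exact_mod_cast hml)
  have hr : (0 : ℝ) < (r : ℝ) - s := sub_pos.mpr (by exact_mod_cast hrs)
  have hm : (0 : ℝ) < (m : ℝ) - s := sub_pos.mpr (by exact_mod_cast hls.trans_lt hml)
  have h1 := concave_seq_mean_increment_le hL hrs.le hmr le_rfl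
  have h2 := concave_seq_mean_increment_le hL hls hml.le le_rfl
  calc (L m - L l) / ((m : ℝ) - l) ≤ (L m - L s) / ((m : ℝ) - s) := by
        rw [div_le_div_iff₀ hl hm]; linarith
    _ ≤ (L r - L s) / ((r : ℝ) - s) := by
        rw [div_le_div_iff₀ hm hr]; linarith

/-- Generalized Newton–MacLaurin inequality: for `λ ∈ Γ_m` and integers
`m > l ≥ 0`, `r > s ≥ 0`, `m ≥ r`, `l ≥ s`, `m ≤ n`,
`[(σ_m(λ)/C_n^m)/(σ_l(λ)/C_n^l)]^{1/(m-l)} ≤ [(σ_r(λ)/C_n^r)/(σ_s(λ)/C_n^s)]^{1/(r-s)}`. -/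
theorem newton_maclaurin (n m l r s : ℕ) (hn : 1 ≤ n) (hml : l < m) (hrs : s < r)
    (hmr : r ≤ m) (hls : s ≤ l) (hmn : m ≤ n)
    (lam : Fin n → ℝ) (hlam : lam ∈ GardingCone n m) :
    ((esymm n m lam / (n.choose m : ℝ)) / (esymm n l lam / (n.choose l : ℝ))) ^
        ((1 : ℝ) / ((m : ℝ) - (l : ℝ))) ≤
      ((esymm n r lam / (n.choose r : ℝ)) / (esymm n s lam / (n.choose s : ℝ))) ^
        ((1 : ℝ) / ((r : ℝ) - (s : ℝ))) := by
  have hpos : ∀ k ≤ m, 0 < esymm n k lam / (n.choose k : ℝ) := by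
    intro k hk
    have hchoose : (0 : ℝ) < n.choose k := by exact_mod_cast Nat.choose_pos (hk.trans hmn)
    refine div_pos ?_ hchoose
    rcases k.eq_zero_or_pos with rfl | hk0
    · simp [esymm]
    · exact hlam k hk0 hk
  have hL : ∀ k, k + 2 ≤ m →
      Real.log (esymm n k lam / n.choose k) + Real.log (esymm n (k + 2) lam / n.choose (k + 2)) ≤
        2 * Real.log (esymm n (k + 1) lam / n.choose (k + 1)) := by
    intro k hk
    have h0 := hpos k (by omega)
    have h2 := hpos (k + 2) hk
    rw [← Real.log_mul h0.ne' h2.ne']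
    have h := Real.log_le_log (mul_pos h0 h2) (esymm_div_choose_mul_le_sq (hk.trans hmn) lam)
    rwa [Real.log_pow, Nat.cast_two] at h
  have key := concave_seq_slope_le (L := fun k => Real.log (esymm n k lam / n.choose k))
    hL hml hrs hmr hls
  have pm := hpos m le_rfl
  have pl := hpos l hml.le
  have pr := hpos r hmr
  have ps := hpos s (hrs.le.trans hmr)
  rw [Real.rpow_def_of_pos (div_pos pm pl), Real.rpow_def_of_pos (div_pos pr ps),
    Real.log_div pm.ne' pl.ne', Real.log_div pr.ne' ps.ne', Real.exp_le_exp,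
    mul_one_div, mul_one_div]
  exact key
end

section
/- Let 2 ≤ k ≤ n be integers, let λ ∈ Γ_k, and let 1 ≤ i ≤ n. Then σ_{k−1}(λ|i)·σ_{k−1}(λ) − σ_k(λ)·σ_{k−2}(λ|i) > 0; that is, the partial derivative of the quotient σ_k/σ_{k−1} with respect to λ_i is strictly positive on Γ_k. -/
open Polynomial in
/-- Newton's inequality for the coefficients of a real-rooted polynomial, with a constant that does
not depend on the degree. -/
theorem Polynomial.Splits.newton_inequality {p : ℝ[X]} (hp : p.Splits) (j : ℕ) :
    ((j : ℝ) + 2) * (p.coeff j * p.coeff (j + 2)) ≤ ((j : ℝ) + 1) * p.coeff (j + 1) ^ 2 := by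
  induction j generalizing p with
  | zero => simpa using hp.two_mul_coeff_zero_mul_coeff_two_le
  | succ j ih =>
    have h := ih hp.derivative_real
    simp only [coeff_derivative] at h
    push_cast at h ⊢
    have hj : (0 : ℝ) < ((j : ℝ) + 1) * (j + 2) := by positivity
    have : 0 ≤ (((j : ℝ) + 1) * (j + 2)) * (((j : ℝ) + 2) * p.coeff (j + 2) ^ 2 -
        ((j : ℝ) + 3) * (p.coeff (j + 1) * p.coeff (j + 3))) := by
      linear_combination h
    have := nonneg_of_mul_nonneg_right this hj
    ring_nf at this ⊢
    linarith

open Polynomial in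
/-- The generating polynomial of the elementary symmetric functions. -/
theorem coeff_prod_one_add_eq_esymm (n m : ℕ) (lam : Fin n → ℝ) :
    (∏ i, (1 + C (lam i) * X)).coeff m = esymm n m lam := by
  simp_rw [Finset.prod_one_add, finsetSum_coeff, Finset.prod_mul_distrib, Finset.prod_const,
    ← map_prod, coeff_C_mul_X_pow]
  rw [← Finset.sum_filter, esymm, Finset.powersetCard_eq_filter]
  simp only [eq_comm]

open Polynomial in
theorem esymm_newton_inequality (n j : ℕ) (lam : Fin n → ℝ) :
    ((j : ℝ) + 2) * (esymm n j lam * esymm n (j + 2) lam) ≤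
      ((j : ℝ) + 1) * esymm n (j + 1) lam ^ 2 := by
  simp only [← coeff_prod_one_add_eq_esymm]
  refine Splits.newton_inequality (Splits.prod fun i _ => Splits.of_natDegree_le_one ?_) j
  compute_degree

open Polynomial in
/-- `σ_{m+1}(λ) = σ_{m+1}(λ|i) + λ_i σ_m(λ|i)`. -/
theorem esymm_succ_eq (n m : ℕ) (lam : Fin n → ℝ) (i : Fin n) :
    esymm n (m + 1) lam = esymm n (m + 1) (Function.update lam i 0) +
      lam i * esymm n m (Function.update lam i 0) := by
  have h : ∏ j, (1 + C (lam j) * X) =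
      (∏ j, (1 + C (Function.update lam i 0 j) * X)) * (1 + C (lam i) * X) := by
    rw [← Finset.mul_prod_erase _ _ (Finset.mem_univ i),
      ← Finset.mul_prod_erase _ (fun j => 1 + C (Function.update lam i 0 j) * X)
        (Finset.mem_univ i), mul_comm]
    simp only [Function.update_self, map_zero, zero_mul, add_zero, one_mul]
    congr 1
    refine Finset.prod_congr rfl fun j hj => ?_
    rw [Function.update_of_ne (Finset.ne_of_mem_erase hj)]
  simp only [← coeff_prod_one_add_eq_esymm, h]
  rw [mul_add, mul_one, coeff_add, mul_left_comm, coeff_C_mul, coeff_mul_X]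

/-- If `λ ∈ Γ_k`, then `σ_j(λ|i) > 0` for all `j < k`. -/
theorem esymm_update_zero_pos {n k : ℕ} {lam : Fin n → ℝ} (hlam : lam ∈ GardingCone n k)
    (i : Fin n) (j : ℕ) (hj : j < k) : 0 < esymm n j (Function.update lam i 0) := by
  induction j with
  | zero => simp [esymm_zero_right]
  | succ j ih =>
    have h₀ := ih (by omega)
    have h₁ := hlam (j + 1) (by omega) (by omega)
    have h₂ := hlam (j + 2) (by omega) (by omega)
    have hN := esymm_newton_inequality n j (Function.update lam i 0)
    rw [esymm_succ_eq n _ lam i] at h₁ h₂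
    generalize esymm n j (Function.update lam i 0) = a at *
    generalize esymm n (j + 1) (Function.update lam i 0) = b at *
    generalize esymm n (j + 2) (Function.update lam i 0) = c at *
    by_contra! hb
    have hx : 0 < lam i := pos_of_mul_pos_left (by linarith : 0 < lam i * a) h₀.le
    have hc : 0 < c := by nlinarith
    have hac : b ^ 2 < a * c := by nlinarith
    have hj : (0 : ℝ) ≤ j := j.cast_nonneg
    nlinarith [mul_pos h₀ hc]

/-- For `2 ≤ k ≤ n`, `λ ∈ Γ_k` and `1 ≤ i ≤ n`:
`σ_{k-1}(λ|i)·σ_{k-1}(λ) - σ_k(λ)·σ_{k-2}(λ|i) > 0`, i.e. the partial derivative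
of `σ_k/σ_{k-1}` with respect to `λ_i` is strictly positive on `Γ_k`. -/
theorem quotient_deriv_pos (n k : ℕ) (hk : 2 ≤ k) (hkn : k ≤ n)
    (lam : Fin n → ℝ) (hlam : lam ∈ GardingCone n k) (i : Fin n) :
    0 < esymm n (k - 1) (Function.update lam i 0) * esymm n (k - 1) lam -
        esymm n k lam * esymm n (k - 2) (Function.update lam i 0) := by
  obtain ⟨j, rfl⟩ : ∃ j, k = j + 2 := ⟨k - 2, by omega⟩
  have hb := esymm_update_zero_pos hlam i (j + 1) (by omega)
  have hN := esymm_newton_inequality n j (Function.update lam i 0)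
  rw [show j + 2 - 1 = j + 1 by omega, Nat.add_sub_cancel, esymm_succ_eq n j lam i,
    esymm_succ_eq n (j + 1) lam i]
  have hj : (0 : ℝ) ≤ j := j.cast_nonneg
  have hlt : esymm n j (Function.update lam i 0) * esymm n (j + 2) (Function.update lam i 0) <
      esymm n (j + 1) (Function.update lam i 0) ^ 2 := by
    nlinarith [pow_pos hb 2]
  linarith
end

section
/- Let 2 ≤ k ≤ n be integers, let α_0, α_1, …, α_{k−1} be positive real numbers, and let λ ∈ Γ_k satisfy σ_k(λ) = Σ_{l=0}^{k−1} α_l·σ_l(λ). Then for every 0 ≤ l ≤ k−2 one has 0 < σ_l(λ)/σ_{k−1}(λ) ≤ max( 1/α_l , (C_n^k)^{k−1−l}·C_n^l/(C_n^{k−1})^{k−l} ). -/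
open Polynomial in
/-- Laguerre's inequality at the origin for a monic product of real linear factors. -/
theorem laguerre_prod_X_sub_C (s : Multiset ℝ) :
    let p := (s.map fun a => X - C a).prod
    2 * (s.card : ℝ) * p.coeff 0 * p.coeff 2 ≤ ((s.card : ℝ) - 1) * p.coeff 1 ^ 2 := by
  induction s using Multiset.induction with
  | empty => simp [coeff_one]
  | cons a s ih =>
    simp only [Multiset.map_cons, Multiset.prod_cons, Multiset.card_cons] at ih ⊢
    set q := (s.map fun a => X - C a).prod with hq
    have h0 : ((X - C a) * q).coeff 0 = -a * q.coeff 0 := by simp [sub_mul]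
    have h1 : ((X - C a) * q).coeff 1 = q.coeff 0 - a * q.coeff 1 := by
      simp [sub_mul, coeff_X_mul]
    have h2 : ((X - C a) * q).coeff 2 = q.coeff 1 - a * q.coeff 2 := by
      simp [sub_mul, coeff_X_mul]
    rw [h0, h1, h2]
    push_cast
    rcases Nat.eq_zero_or_pos s.card with hs | hs
    · have hs' : s = 0 := Multiset.card_eq_zero.mp hs
      have hq1 : q = 1 := by simp [hq, hs']
      simp [hq1, hs', coeff_one]
    · have hm : (0 : ℝ) < s.card := by exact_mod_cast hs
      set m := (s.card : ℝ)
      set x := q.coeff 0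
      set y := q.coeff 1
      set z := q.coeff 2
      have key : 0 ≤ m * (m * (x - a * y) ^ 2 - 2 * (m + 1) * (-a * x) * (y - a * z)) := by
        have e : m * (m * (x - a * y) ^ 2 - 2 * (m + 1) * (-a * x) * (y - a * z)) =
            (m * x + a * y) ^ 2 + (m + 1) * a ^ 2 * ((m - 1) * y ^ 2 - 2 * m * x * z) := by ring
        rw [e]
        have : 0 ≤ (m - 1) * y ^ 2 - 2 * m * x * z := by linarith
        positivity
      have := nonneg_of_mul_nonneg_right key hm
      linarith

open Polynomial in
/-- Laguerre's inequality at the origin for a polynomial that splits over `ℝ`. -/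
theorem Polynomial.Splits.laguerre {p : ℝ[X]} (hp : p.Splits) :
    2 * (p.natDegree : ℝ) * p.coeff 0 * p.coeff 2 ≤ ((p.natDegree : ℝ) - 1) * p.coeff 1 ^ 2 := by
  have h := laguerre_prod_X_sub_C p.roots
  have e := hp.eq_prod_roots
  rw [← hp.natDegree_eq_card_roots] at h
  have hc (i : ℕ) : p.coeff i =
      p.leadingCoeff * ((p.roots.map fun a => X - C a).prod).coeff i := by
    conv_lhs => rw [e]
    rw [coeff_C_mul]
  rw [hc 0, hc 1, hc 2]
  dsimp only at h
  nlinarith [mul_le_mul_of_nonneg_left h (sq_nonneg p.leadingCoeff)]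

open Polynomial in
theorem Polynomial.Splits.iterate_derivative_real {p : ℝ[X]} (hp : p.Splits) (i : ℕ) :
    (derivative^[i] p).Splits := by
  induction i with
  | zero => exact hp
  | succ i ih => rw [Function.iterate_succ_apply']; exact ih.derivative_real

open Polynomial in
theorem natDegree_iterate_derivative_real (p : ℝ[X]) (i : ℕ) :
    (derivative^[i] p).natDegree = p.natDegree - i := by
  induction i with
  | zero => rfl
  | succ i ih => rw [Function.iterate_succ_apply', natDegree_derivative, ih]; omega

open Polynomial in
/-- Newton's inequality for the coefficients of a polynomial that splits over `ℝ`. -/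
theorem Polynomial.Splits.newton {p : ℝ[X]} (hp : p.Splits) {i : ℕ} (hi : i ≤ p.natDegree) :
    ((p.natDegree : ℝ) - i) * (i + 2) * (p.coeff i * p.coeff (i + 2)) ≤
      ((p.natDegree : ℝ) - i - 1) * (i + 1) * p.coeff (i + 1) ^ 2 := by
  have h := (hp.iterate_derivative_real i).laguerre
  rw [natDegree_iterate_derivative_real] at h
  simp only [coeff_iterate_derivative, nsmul_eq_mul, Nat.cast_sub hi, zero_add] at h
  have e0 : (i.descFactorial i : ℝ) = i.factorial := by rw [Nat.descFactorial_self]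
  have e1 : ((i + 1).descFactorial i : ℝ) = (i + 1) * i.factorial := by
    have := Nat.factorial_mul_descFactorial (Nat.le_add_right i 1)
    rw [Nat.add_sub_cancel_left, Nat.factorial_one, one_mul, Nat.factorial_succ] at this
    exact_mod_cast this
  have e2 : 2 * ((i + 2).descFactorial i : ℝ) = (i + 2) * (i + 1) * i.factorial := by
    have := Nat.factorial_mul_descFactorial (Nat.le_add_right i 2)
    rw [Nat.add_sub_cancel_left, Nat.factorial_two, Nat.factorial_succ, Nat.factorial_succ,
      ← mul_assoc] at this
    exact_mod_cast this
  rw [e0, Nat.add_comm 1 i, Nat.add_comm 2 i, e1] at h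
  have hf : (0 : ℝ) < (i + 1) * (i.factorial : ℝ) ^ 2 := by positivity
  refine le_of_mul_le_mul_left ?_ hf
  calc _ = ((p.natDegree : ℝ) - i) * (i.factorial * p.coeff i) *
        ((i + 2) * (i + 1) * i.factorial * p.coeff (i + 2)) := by ring
    _ = 2 * ((p.natDegree : ℝ) - i) * (i.factorial * p.coeff i) *
        (((i + 2).descFactorial i : ℝ) * p.coeff (i + 2)) := by rw [← e2]; ring
    _ ≤ _ := h
    _ = _ := by ring

open Polynomial in
/-- Newton's inequality for the elementary symmetric functions of arbitrary reals. -/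
theorem esymm_newton {n j : ℕ} (hj : j + 2 ≤ n) (lam : Fin n → ℝ) :
    ((j : ℝ) + 2) * (n - j) * (esymm n j lam * esymm n (j + 2) lam) ≤
      (j + 1) * (n - j - 1) * esymm n (j + 1) lam ^ 2 := by
  set p : ℝ[X] := ∏ i, (X + C (lam i)) with hpdef
  have hp : p.Splits := Splits.prod fun i _ => Splits.X_add_C (lam i)
  have hd : p.natDegree = n := by
    rw [hpdef, natDegree_prod_of_monic _ _ fun i _ => monic_X_add_C _]; simp
  have hc (m : ℕ) (hm : m ≤ n) : p.coeff (n - m) = esymm n m lam := by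
    rw [hpdef, Finset.prod_X_add_C_coeff _ _ (by simp)]
    simp [esymm, Nat.sub_sub_self hm]
  obtain ⟨i, rfl⟩ := Nat.exists_eq_add_of_le' hj
  have h := hp.newton (i := i) (by omega)
  rw [← hc j (by omega), ← hc (j + 1) (by omega), ← hc (j + 2) (by omega)]
  rw [show i + (j + 2) - j = i + 2 by omega, show i + (j + 2) - (j + 1) = i + 1 by omega,
    show i + (j + 2) - (j + 2) = i by omega]
  rw [hd] at h
  push_cast at h ⊢
  linarith

/-- Newton's inequality for the normalized elementary symmetric functions. -/
theorem esymm_div_choose_newton {n j : ℕ} (hj : j + 2 ≤ n) (lam : Fin n → ℝ) :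
    esymm n j lam / n.choose j * (esymm n (j + 2) lam / n.choose (j + 2)) ≤
      (esymm n (j + 1) lam / n.choose (j + 1)) ^ 2 := by
  have h := esymm_newton hj lam
  have c0 : (0 : ℝ) < n.choose j := by exact_mod_cast Nat.choose_pos (by omega)
  have hnj : (j : ℝ) + 2 ≤ n := by exact_mod_cast hj
  have e1 : (n.choose (j + 1) : ℝ) = n.choose j * (n - j) / (j + 1) := by
    rw [eq_div_iff (by positivity)]
    have := Nat.choose_succ_right_eq n j
    rw [← Nat.cast_sub (by omega)]; exact_mod_cast this
  have e2 : (n.choose (j + 2) : ℝ) = n.choose (j + 1) * (n - j - 1) / (j + 2) := by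
    rw [eq_div_iff (by positivity)]
    have := Nat.choose_succ_right_eq n (j + 1)
    have e : (n : ℝ) - j - 1 = (n - (j + 1) : ℕ) := by
      rw [Nat.cast_sub (by omega)]; push_cast; ring
    rw [e]; exact_mod_cast this
  have a1 : (0 : ℝ) < n - j := by linarith
  have a2 : (0 : ℝ) < n - j - 1 := by linarith
  rw [e2, e1, div_mul_div_comm, div_pow, div_le_div_iff₀ (by positivity) (by positivity)]
  have hk := mul_le_mul_of_nonneg_left h
    (show 0 ≤ (n.choose j : ℝ) ^ 2 * (n - j) / ((j + 1) ^ 2 * (j + 2)) by positivity)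
  convert hk using 1 <;> field_simp

/-- A positive log-concave sequence whose last ratio is at least `t` grows at least like
`t ^ i`. -/
theorem pow_mul_le_of_log_concave {E : ℕ → ℝ} {t : ℝ} {m : ℕ} (ht : 0 ≤ t)
    (hpos : ∀ j ≤ m, 0 < E j) (hE : ∀ j, j + 2 ≤ m + 1 → E j * E (j + 2) ≤ E (j + 1) ^ 2)
    (hlast : t * E m ≤ E (m + 1)) {l : ℕ} (hl : l ≤ m) : t ^ (m - l) * E l ≤ E m := by
  have step : ∀ j ≤ m, t * E j ≤ E (j + 1) := by
    intro j hj
    induction hj using Nat.decreasingInduction with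
    | self => exact hlast
    | of_succ j hj ih =>
      have h1 := hE j (by omega)
      have h2 := hpos j (by omega)
      have h3 := hpos (j + 1) hj
      refine le_of_mul_le_mul_right ?_ h3
      calc t * E j * E (j + 1) = E j * (t * E (j + 1)) := by ring
        _ ≤ E j * E (j + 2) := mul_le_mul_of_nonneg_left ih h2.le
        _ ≤ E (j + 1) * E (j + 1) := by rw [← sq]; exact h1
  induction hl using Nat.decreasingInduction with
  | self => simp
  | of_succ l hl ih =>
    refine le_trans ?_ ih
    rw [show m - l = m - (l + 1) + 1 by omega, pow_succ, mul_assoc]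
    exact mul_le_mul_of_nonneg_left (step l (by omega)) (pow_nonneg ht _)

/-- For `2 ≤ k ≤ n`, positive `α_0, …, α_{k-1}`, and `λ ∈ Γ_k` with
`σ_k(λ) = Σ_{l=0}^{k-1} α_l·σ_l(λ)`, one has for every `0 ≤ l ≤ k-2`:
`0 < σ_l(λ)/σ_{k-1}(λ) ≤ max(1/α_l, (C_n^k)^{k-1-l}·C_n^l/(C_n^{k-1})^{k-l})`. -/
theorem ratio_bounds (n k : ℕ) (hk : 2 ≤ k) (hkn : k ≤ n) (α : ℕ → ℝ)
    (hα : ∀ l, l < k → 0 < α l) (lam : Fin n → ℝ) (hlam : lam ∈ GardingCone n k)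
    (heq : esymm n k lam = ∑ l ∈ Finset.range k, α l * esymm n l lam) :
    ∀ l, l ≤ k - 2 →
      0 < esymm n l lam / esymm n (k - 1) lam ∧
        esymm n l lam / esymm n (k - 1) lam ≤
          max (1 / α l)
            ((n.choose k : ℝ) ^ (k - 1 - l) * (n.choose l : ℝ) /
              (n.choose (k - 1) : ℝ) ^ (k - l)) := by
  intro l hl
  have hpos (j : ℕ) (hj : j ≤ k) : 0 < esymm n j lam := by
    rcases Nat.eq_zero_or_pos j with rfl | h
    · simp [esymm]
    · exact hlam j h hj
  have hσl := hpos l (by omega)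
  have hσ := hpos (k - 1) (by omega)
  have hαl := hα l (by omega)
  refine ⟨div_pos hσl hσ, ?_⟩
  rcases le_total (esymm n k lam) (esymm n (k - 1) lam) with hle | hle
  · refine le_max_of_le_left ?_
    rw [div_le_div_iff₀ hσ hαl, one_mul, mul_comm]
    refine le_trans ?_ hle
    rw [heq]
    exact Finset.single_le_sum (f := fun l => α l * esymm n l lam)
      (fun i hi => (mul_pos (hα i (Finset.mem_range.mp hi))
        (hpos i (Finset.mem_range.mp hi).le)).le) (Finset.mem_range.mpr (by omega))
  · refine le_max_of_le_right ?_
    obtain ⟨m, rfl⟩ : ∃ m, k = m + 1 := ⟨k - 1, by omega⟩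
    simp only [Nat.add_sub_cancel] at *
    have hc (j : ℕ) (hj : j ≤ m + 1) : (0 : ℝ) < n.choose j := by
      exact_mod_cast Nat.choose_pos (by omega)
    have cl := hc l (by omega)
    have cm := hc m (by omega)
    have ck := hc (m + 1) le_rfl
    have h := pow_mul_le_of_log_concave (E := fun j => esymm n j lam / n.choose j)
      (t := n.choose m / n.choose (m + 1)) (m := m) (by positivity)
      (fun j hj => div_pos (hpos j (by omega)) (hc j (by omega)))
      (fun j hj => esymm_div_choose_newton (by omega) lam)
      (by
        rw [div_mul_div_comm, mul_comm (n.choose (m + 1) : ℝ), mul_div_mul_left _ _ cm.ne']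
        gcongr)
      (l := l) (by omega)
    rw [div_pow, div_mul_div_comm, div_le_div_iff₀ (by positivity) cm] at h
    rw [show m + 1 - l = m - l + 1 by omega, div_le_div_iff₀ hσ (by positivity), pow_succ]
    linarith
end

section
/- Let 2 ≤ k ≤ n be integers, let α_0, α_1, …, α_{k−1} be positive real numbers, and let λ ∈ Γ_k satisfy σ_k(λ) = Σ_{l=0}^{k−1} α_l·σ_l(λ). Define G^{ii}(λ) = [ σ_{k−1}(λ|i)·σ_{k−1}(λ) − σ_k(λ)·σ_{k−2}(λ|i) − Σ_{l=0}^{k−2} α_l·( σ_{l−1}(λ|i)·σ_{k−1}(λ) − σ_l(λ)·σ_{k−2}(λ|i) ) ] / σ_{k−1}(λ)². Then Σ_{i=1}^n G^{ii}(λ) < n−k+1. -/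
/-- The `m`-th elementary symmetric function for an integer index `m`, with
`σ_m = 0` for `m < 0`. -/
def esymmZ (n : ℕ) (m : ℤ) (lam : Fin n → ℝ) : ℝ :=
  if 0 ≤ m then esymm n m.toNat lam else 0

/-- `G^{ii}(λ)`, the partial derivative with respect to `λ_i` of the operator
`G(λ) = σ_k(λ)/σ_{k-1}(λ) - Σ_{l=0}^{k-2} α_l·σ_l(λ)/σ_{k-1}(λ)`:
`G^{ii}(λ) = [σ_{k-1}(λ|i)·σ_{k-1}(λ) - σ_k(λ)·σ_{k-2}(λ|i)
  - Σ_{l=0}^{k-2} α_l·(σ_{l-1}(λ|i)·σ_{k-1}(λ) - σ_l(λ)·σ_{k-2}(λ|i))] / σ_{k-1}(λ)²`. -/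
noncomputable def Gii (n k : ℕ) (α : ℕ → ℝ) (lam : Fin n → ℝ) (i : Fin n) : ℝ :=
  (esymm n (k - 1) (Function.update lam i 0) * esymm n (k - 1) lam -
      esymm n k lam * esymm n (k - 2) (Function.update lam i 0) -
      ∑ l ∈ Finset.range (k - 1),
        α l * (esymmZ n ((l : ℤ) - 1) (Function.update lam i 0) * esymm n (k - 1) lam -
          esymm n l lam * esymm n (k - 2) (Function.update lam i 0))) /
    (esymm n (k - 1) lam) ^ 2

/-- Setting the entry `i` to zero kills exactly the monomials that contain `i`. -/
theorem prod_update_zero (n : ℕ) (lam : Fin n → ℝ) (i : Fin n) (s : Finset (Fin n)) :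
    ∏ j ∈ s, Function.update lam i 0 j = if i ∈ s then 0 else ∏ j ∈ s, lam j := by
  split_ifs with h
  · exact Finset.prod_eq_zero h (by simp)
  · refine Finset.prod_congr rfl fun j hj => ?_
    rw [Function.update_of_ne]
    rintro rfl
    exact h hj

/-- `Σ_i σ_m(λ|i) = (n - m) σ_m(λ)`. -/
theorem sum_esymm_update (n m : ℕ) (lam : Fin n → ℝ) :
    ∑ i : Fin n, esymm n m (Function.update lam i 0) = ((n : ℝ) - m) * esymm n m lam := by
  simp only [esymm, prod_update_zero]
  rw [Finset.sum_comm, Finset.mul_sum]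
  refine Finset.sum_congr rfl fun s hs => ?_
  have hcard : s.card = m := (Finset.mem_powersetCard.1 hs).2
  have hle : s.card ≤ n := by simpa using Finset.card_le_univ s
  have hcompl : (Finset.univ.filter fun i : Fin n => i ∉ s) = sᶜ := by
    ext i
    simp
  rw [Finset.sum_ite, Finset.sum_const_zero, zero_add, Finset.sum_const, hcompl,
    Finset.card_compl, Fintype.card_fin, nsmul_eq_mul, Nat.cast_sub hle, hcard]

theorem esymm_pos_of_mem_gardingCone {n k : ℕ} {lam : Fin n → ℝ} (h : lam ∈ GardingCone n k)
    {j : ℕ} (hj : j ≤ k) : 0 < esymm n j lam := by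
  rcases Nat.eq_zero_or_pos j with rfl | hpos
  · simp [esymm]
  · exact h j hpos hj

/-- The integer-index sums `Σ_i σ_{l-1}(λ|i)` are nonnegative on the Gårding cone. -/
theorem sum_esymmZ_update_nonneg {n k : ℕ} (hkn : k ≤ n) {lam : Fin n → ℝ}
    (h : lam ∈ GardingCone n k) {l : ℕ} (hl : l ≤ k) :
    0 ≤ ∑ i : Fin n, esymmZ n ((l : ℤ) - 1) (Function.update lam i 0) := by
  rcases l with _ | m
  · simp [esymmZ]
  · have hm : (m : ℝ) ≤ n := by exact_mod_cast (by omega : m ≤ n)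
    have hidx : ∀ i : Fin n, esymmZ n (((m + 1 : ℕ) : ℤ) - 1) (Function.update lam i 0) =
        esymm n m (Function.update lam i 0) := fun i => by simp [esymmZ]
    simp only [hidx, sum_esymm_update]
    exact mul_nonneg (by linarith) (esymm_pos_of_mem_gardingCone h (by omega)).le

/-- For `2 ≤ k ≤ n`, positive `α_0, …, α_{k-1}` and `λ ∈ Γ_k` satisfying
`σ_k(λ) = Σ_{l=0}^{k-1} α_l·σ_l(λ)`: `Σ_{i=1}^n G^{ii}(λ) < n-k+1`. -/
theorem sum_Gii_lt (n k : ℕ) (hk : 2 ≤ k) (hkn : k ≤ n) (α : ℕ → ℝ)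
    (hα : ∀ l, l < k → 0 < α l) (lam : Fin n → ℝ) (hlam : lam ∈ GardingCone n k)
    (heq : esymm n k lam = ∑ l ∈ Finset.range k, α l * esymm n l lam) :
    ∑ i : Fin n, Gii n k α lam i < (n : ℝ) - (k : ℝ) + 1 := by
  obtain ⟨p, rfl⟩ : ∃ p, k = p + 2 := ⟨k - 2, by omega⟩
  have hS : 0 < esymm n (p + 1) lam := esymm_pos_of_mem_gardingCone hlam (by omega)
  have hT : 0 < esymm n p lam := esymm_pos_of_mem_gardingCone hlam (by omega)
  have ha : 0 < α (p + 1) := hα _ (by omega)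
  have hpn : (p : ℝ) + 2 ≤ n := by exact_mod_cast hkn
  have hR : 0 ≤ ∑ l ∈ Finset.range (p + 1),
      α l * ∑ i : Fin n, esymmZ n ((l : ℤ) - 1) (Function.update lam i 0) := by
    refine Finset.sum_nonneg fun l hl => ?_
    have hl' := Finset.mem_range.1 hl
    exact mul_nonneg (hα l (by omega)).le (sum_esymmZ_update_nonneg hkn hlam (by omega))
  rw [Finset.sum_range_succ] at heq
  simp only [Gii, show p + 2 - 1 = p + 1 by omega, show p + 2 - 2 = p by omega]
  rw [← Finset.sum_div, div_lt_iff₀ (by positivity)]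
  have hsum : ∑ i : Fin n, ∑ l ∈ Finset.range (p + 1),
        α l * (esymmZ n ((l : ℤ) - 1) (Function.update lam i 0) * esymm n (p + 1) lam -
          esymm n l lam * esymm n p (Function.update lam i 0)) =
      (∑ l ∈ Finset.range (p + 1),
        α l * ∑ i : Fin n, esymmZ n ((l : ℤ) - 1) (Function.update lam i 0)) *
          esymm n (p + 1) lam -
      (∑ l ∈ Finset.range (p + 1), α l * esymm n l lam) * (((n : ℝ) - p) * esymm n p lam) := by
    rw [Finset.sum_comm, Finset.sum_mul, Finset.sum_mul, ← Finset.sum_sub_distrib]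
    refine Finset.sum_congr rfl fun l _ => ?_
    rw [← Finset.mul_sum, Finset.sum_sub_distrib, ← Finset.sum_mul, ← Finset.mul_sum,
      sum_esymm_update]
    ring
  rw [Finset.sum_sub_distrib, Finset.sum_sub_distrib, hsum, ← Finset.sum_mul, ← Finset.mul_sum,
    sum_esymm_update, sum_esymm_update, heq]
  have hgain : 0 < α (p + 1) * esymm n (p + 1) lam * (((n : ℝ) - p) * esymm n p lam) :=
    mul_pos (mul_pos ha hS) (mul_pos (by linarith) hT)
  have hrest := mul_nonneg hR hS.le
  push_cast
  linarith
end

section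
/- Let 2 ≤ k ≤ n be integers, let α_0, α_1, …, α_{k−1} be positive real numbers, and let λ ∈ Γ_k satisfy σ_k(λ) = Σ_{l=0}^{k−1} α_l·σ_l(λ). Define G^{ii}(λ) = [ σ_{k−1}(λ|i)·σ_{k−1}(λ) − σ_k(λ)·σ_{k−2}(λ|i) − Σ_{l=0}^{k−2} α_l·( σ_{l−1}(λ|i)·σ_{k−1}(λ) − σ_l(λ)·σ_{k−2}(λ|i) ) ] / σ_{k−1}(λ)². Then Σ_{i=1}^n λ_i·G^{ii}(λ) = α_{k−1} + Σ_{l=0}^{k−2} (k−l)·α_l·σ_l(λ)/σ_{k−1}(λ); in particular Σ_{i=1}^n λ_i·G^{ii}(λ) ≥ α_{k−1}. -/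
lemma mul_esymm_update_zero (n m : ℕ) (lam : Fin n → ℝ) (i : Fin n) :
    lam i * esymm n m (Function.update lam i 0) =
      ∑ t ∈ (Finset.univ : Finset (Fin n)).powersetCard (m + 1) with i ∈ t,
        ∏ j ∈ t, lam j := by
  have hvanish : esymm n m (Function.update lam i 0) =
      ∑ s ∈ (Finset.univ : Finset (Fin n)).powersetCard m with i ∉ s, ∏ j ∈ s, lam j := by
    rw [esymm, Finset.sum_filter]
    refine Finset.sum_congr rfl fun s _ => ?_
    split_ifs with h
    · exact Finset.prod_eq_zero h (Function.update_self i 0 lam)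
    · exact Finset.prod_congr rfl fun j hj =>
        Function.update_of_ne (ne_of_mem_of_not_mem hj h) _ _
  rw [hvanish, Finset.mul_sum]
  refine Finset.sum_nbij' (fun s => insert i s) (fun t => t.erase i) ?_ ?_ ?_ ?_ ?_
  · intro s hs
    simp only [Finset.mem_filter, Finset.mem_powersetCard_univ] at hs ⊢
    exact ⟨by rw [Finset.card_insert_of_notMem hs.2, hs.1], Finset.mem_insert_self i s⟩
  · intro t ht
    simp only [Finset.mem_filter, Finset.mem_powersetCard_univ] at ht ⊢
    exact ⟨by rw [Finset.card_erase_of_mem ht.2, ht.1, Nat.add_sub_cancel],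
      Finset.notMem_erase i t⟩
  · intro s hs
    exact Finset.erase_insert (Finset.mem_filter.mp hs).2
  · intro t ht
    exact Finset.insert_erase (Finset.mem_filter.mp ht).2
  · intro s hs
    exact (Finset.prod_insert (Finset.mem_filter.mp hs).2).symm

lemma sum_mul_esymm_update_zero (n m : ℕ) (lam : Fin n → ℝ) :
    ∑ i, lam i * esymm n m (Function.update lam i 0) = ((m : ℝ) + 1) * esymm n (m + 1) lam := by
  simp_rw [mul_esymm_update_zero, Finset.sum_filter]
  rw [Finset.sum_comm, esymm, Finset.mul_sum]
  refine Finset.sum_congr rfl fun t ht => ?_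
  rw [← Finset.sum_filter, Finset.filter_mem_eq_inter, Finset.univ_inter, Finset.sum_const,
    Finset.mem_powersetCard_univ.mp ht, nsmul_eq_mul]
  push_cast
  rfl

lemma sum_mul_esymmZ_update_zero (n l : ℕ) (lam : Fin n → ℝ) :
    ∑ i, lam i * esymmZ n ((l : ℤ) - 1) (Function.update lam i 0) = (l : ℝ) * esymm n l lam := by
  cases l with
  | zero => simp [esymmZ]
  | succ m => simpa [esymmZ] using sum_mul_esymm_update_zero n m lam

/-- For `2 ≤ k ≤ n`, positive `α_0, …, α_{k-1}` and `λ ∈ Γ_k` satisfying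
`σ_k(λ) = Σ_{l=0}^{k-1} α_l·σ_l(λ)`:
`Σ_{i=1}^n λ_i·G^{ii}(λ) = α_{k-1} + Σ_{l=0}^{k-2} (k-l)·α_l·σ_l(λ)/σ_{k-1}(λ)`;
in particular `Σ_{i=1}^n λ_i·G^{ii}(λ) ≥ α_{k-1}`. -/
theorem sum_mul_Gii_eq (n k : ℕ) (hk : 2 ≤ k) (hkn : k ≤ n) (α : ℕ → ℝ)
    (hα : ∀ l, l < k → 0 < α l) (lam : Fin n → ℝ) (hlam : lam ∈ GardingCone n k)
    (heq : esymm n k lam = ∑ l ∈ Finset.range k, α l * esymm n l lam) :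
    (∑ i : Fin n, lam i * Gii n k α lam i =
        α (k - 1) +
          ∑ l ∈ Finset.range (k - 1),
            ((k : ℝ) - (l : ℝ)) * α l * (esymm n l lam / esymm n (k - 1) lam)) ∧
      α (k - 1) ≤ ∑ i : Fin n, lam i * Gii n k α lam i := by
  obtain ⟨k, rfl⟩ := Nat.exists_eq_add_of_le' hk
  simp only [show k + 2 - 1 = k + 1 from rfl] at *
  have hpos : 0 < esymm n (k + 1) lam := hlam (k + 1) (by omega) (by omega)
  have hnonneg : ∀ l, l < k + 1 → 0 ≤ esymm n l lam := by
    intro l hl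
    rcases Nat.eq_zero_or_pos l with rfl | h
    · simp [esymm]
    · exact (hlam l h (by omega)).le
  have hk1 := sum_mul_esymm_update_zero n (k + 1) lam
  have hk0 := sum_mul_esymm_update_zero n k lam
  have hsum : ∑ i : Fin n, lam i * Gii n (k + 2) α lam i =
      α (k + 1) + ∑ l ∈ Finset.range (k + 1),
        (((k + 2 : ℕ) : ℝ) - (l : ℝ)) * α l * (esymm n l lam / esymm n (k + 1) lam) := by
    have hlow : ∑ i, lam i * ∑ l ∈ Finset.range (k + 1),
        α l * (esymmZ n ((l : ℤ) - 1) (Function.update lam i 0) * esymm n (k + 1) lam -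
          esymm n l lam * esymm n k (Function.update lam i 0)) =
        ∑ l ∈ Finset.range (k + 1),
          α l * ((l : ℝ) - (k + 1)) * esymm n l lam * esymm n (k + 1) lam := by
      simp_rw [Finset.mul_sum]
      rw [Finset.sum_comm]
      refine Finset.sum_congr rfl fun l _ => ?_
      calc _ = α l * esymm n (k + 1) lam *
              (∑ i, lam i * esymmZ n ((l : ℤ) - 1) (Function.update lam i 0)) -
            α l * esymm n l lam * ∑ i, lam i * esymm n k (Function.update lam i 0) := by
            rw [Finset.mul_sum, Finset.mul_sum, ← Finset.sum_sub_distrib]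
            exact Finset.sum_congr rfl fun i _ => by ring
        _ = _ := by rw [sum_mul_esymmZ_update_zero, hk0]; ring
    have hnum : ∑ i : Fin n, lam i * Gii n (k + 2) α lam i =
        (esymm n (k + 1) lam * (∑ i, lam i * esymm n (k + 1) (Function.update lam i 0)) -
          esymm n (k + 2) lam * (∑ i, lam i * esymm n k (Function.update lam i 0)) -
          ∑ i, lam i * ∑ l ∈ Finset.range (k + 1),
            α l * (esymmZ n ((l : ℤ) - 1) (Function.update lam i 0) * esymm n (k + 1) lam -
              esymm n l lam * esymm n k (Function.update lam i 0))) /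
          esymm n (k + 1) lam ^ 2 := by
      rw [Finset.mul_sum, Finset.mul_sum, ← Finset.sum_sub_distrib, ← Finset.sum_sub_distrib,
        Finset.sum_div]
      refine Finset.sum_congr rfl fun i _ => ?_
      simp only [Gii, Nat.add_sub_cancel, show k + 2 - 1 = k + 1 from rfl]
      ring
    rw [Finset.sum_range_succ] at heq
    have hright : ∑ l ∈ Finset.range (k + 1),
        (((k + 2 : ℕ) : ℝ) - (l : ℝ)) * α l * (esymm n l lam / esymm n (k + 1) lam) =
        (∑ l ∈ Finset.range (k + 1), α l * esymm n l lam) / esymm n (k + 1) lam -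
        (∑ l ∈ Finset.range (k + 1),
          α l * ((l : ℝ) - (k + 1)) * esymm n l lam * esymm n (k + 1) lam) /
            esymm n (k + 1) lam ^ 2 := by
      rw [Finset.sum_div, Finset.sum_div, ← Finset.sum_sub_distrib]
      refine Finset.sum_congr rfl fun l _ => ?_
      push_cast
      field_simp
      ring
    rw [hnum, hlow, hk1, hk0, hright, show k + 1 + 1 = k + 2 from rfl, heq]
    push_cast
    field_simp
    ring
  refine ⟨hsum, hsum ▸ le_add_of_nonneg_right (Finset.sum_nonneg fun l hl => ?_)⟩
  have hl : l < k + 1 := Finset.mem_range.mp hl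
  have hlk : (l : ℝ) ≤ ((k + 2 : ℕ) : ℝ) := by exact_mod_cast (by omega : l ≤ k + 2)
  exact mul_nonneg (mul_nonneg (sub_nonneg.mpr hlk) (hα l (by omega)).le)
    (div_nonneg (hnonneg l hl) hpos.le)
end
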